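/- arXiv:1810.05084 — 2 statements merged into one kernel-verified Lean document; each statement's English description precedes it below -/
import Mathlib

section
/- Let G be a finite group, H a normal subgroup of prime index p, and F an algebraically closed field of characteristic 0 or coprime to |G|. Let x in G be such that G/H is generated by the image of x, and let C̄(x) be the conjugacy class sum of x in F[G]. Let η be an irreducible F-representation of H whose primitive central idempotent e_η in F[H] is central in F[G], so that (C̄(x))^p e_η = λ e_η with λ ≠ 0, and let μ be a p-th root of λ in F and c = C̄(x) e_η / μ. Let ρ_0, …, ρ_{p-1} be the p distinct irreducible representations of G extending η. Then, after a suitable indexing, the primitive central idempotent of F[G] corresponding to ρ_i equals (1/p)(1 + ζ^i c + ζ^{2i} c^2 + … + ζ^{i(p-1)} c^{p-1}) e_η, where ζ is a primitive p-th root of unity in F; moreover e_η = e_{ρ_0} + e_{ρ_1} + … + e_{ρ_{p-1}}. -/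
open scoped TensorProduct

section Defs

variable {k : Type*} [Field k] {M : Type*} [Monoid M]

/-- Equivalence (isomorphism) of representations of a monoid over a field. -/
def RepIso {V W : Type*} [AddCommGroup V] [Module k V] [AddCommGroup W] [Module k W]
    (ρ : Representation k M V) (ρ' : Representation k M W) : Prop :=
  ∃ e : V ≃ₗ[k] W, ∀ (g : M) (v : V), e (ρ g v) = ρ' g (e v)

/-- Irreducibility of a representation: the space is nonzero and has no proper nonzero
invariant subspace. -/
def RepIrred {V : Type*} [AddCommGroup V] [Module k V] (ρ : Representation k M V) : Prop :=
  Nontrivial V ∧ ∀ U : Submodule k V, (∀ g : M, ∀ v ∈ U, ρ g v ∈ U) → U = ⊥ ∨ U = ⊤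

variable {G : Type*} [Group G]

/-- Conjugation by `x` as a monoid homomorphism of a normal subgroup. -/
def conjHom {H : Subgroup G} (hH : H.Normal) (x : G) : H →* H :=
  MonoidHom.mk' (fun h => ⟨x * (h : G) * x⁻¹, hH.conj_mem (h : G) h.2 x⟩)
    (by intro a b; ext; push_cast; group)

/-- The conjugate representation `η^x`, `η^x(h) = η (x h x⁻¹)`. -/
def ConjRep {H : Subgroup G} (hH : H.Normal) (x : G) {V : Type*} [AddCommGroup V] [Module k V]
    (η : Representation k H V) : Representation k H V :=
  η.comp (conjHom hH x)

/-- `ρ` is (a model of) the representation of `G` induced from the representation `η` of the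
subgroup `H`: there is an `H`-equivariant embedding `ι : V → W` and `W` is the internal direct
sum, over the cosets `gH`, of the translates `ρ(g)(ι V)`. -/
def IsInducedFrom (H : Subgroup G) {V W : Type*} [AddCommGroup V] [Module k V]
    [AddCommGroup W] [Module k W]
    (η : Representation k H V) (ρ : Representation k G W) : Prop :=
  ∃ ι : V →ₗ[k] W, Function.Injective ι ∧
    (∀ (h : H) (v : V), ι (η h v) = ρ (h : G) (ι v)) ∧
    ∃ S : G ⧸ H → Submodule k W,
      (∀ g : G, S (g : G ⧸ H) = (LinearMap.range ι).map (ρ g)) ∧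
      iSupIndep S ∧ iSup S = ⊤

/-- The subrepresentation on an invariant subspace. -/
def SubRep {V : Type*} [AddCommGroup V] [Module k V] (ρ : Representation k M V)
    (U : Submodule k V) (hU : ∀ g : M, ∀ v ∈ U, ρ g v ∈ U) : Representation k M U where
  toFun g := LinearMap.restrict (ρ g) (hU g)
  map_one' := by ext v; simp [LinearMap.restrict_apply]
  map_mul' g g' := by ext v; simp [LinearMap.restrict_apply]

/-- The direct sum of a family of representations (realized on the product space). -/
def PiRep {ι : Type*} {W : ι → Type*} [∀ i, AddCommGroup (W i)] [∀ i, Module k (W i)]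
    (ρ : ∀ i, Representation k M (W i)) : Representation k M (∀ i, W i) where
  toFun g := LinearMap.pi fun i => (ρ i g).comp (LinearMap.proj i)
  map_one' := by ext v; simp
  map_mul' g g' := by ext v; simp

/-- Extension of scalars of a representation along a field extension `F ⊆ E`. -/
noncomputable def BaseChangeRep {F : Type*} [Field F] (E : Type*) [Field E] [Algebra F E]
    {V : Type*} [AddCommGroup V] [Module F V] (ρ : Representation F M V) :
    Representation E M (E ⊗[F] V) where
  toFun g := LinearMap.baseChange E (ρ g)
  map_one' := by ext v; simp
  map_mul' g g' := by ext v; simp [map_mul]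

open scoped Classical in
/-- The conjugacy class sum of `x` in the group algebra. -/
noncomputable def classSum (k : Type*) [Field k] {G : Type*} [Group G] [Fintype G] (x : G) :
    MonoidAlgebra k G :=
  ∑ g : G, if IsConj x g then MonoidAlgebra.single g (1 : k) else 0

/-- A primitive central idempotent of a ring. -/
def IsPrimCentralIdem {R : Type*} [Ring R] (e : R) : Prop :=
  e ≠ 0 ∧ IsIdempotentElem e ∧ e ∈ Set.center R ∧
    ∀ f : R, f ∈ Set.center R → IsIdempotentElem f → f * e = f → f = 0 ∨ f = e

/-- `e` is the primitive central idempotent of the group algebra attached to the irreducible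
representation `ρ`: it is a primitive central idempotent acting as the identity on `ρ`. -/
noncomputable def IsIdemFor {V : Type*} [AddCommGroup V] [Module k V]
    (ρ : Representation k M V) (e : MonoidAlgebra k M) : Prop :=
  IsPrimCentralIdem e ∧ ρ.asAlgebraHom e = 1

/-- `ρ'` is the twist of the `E`-representation `ρ` by the automorphism `γ` of `E` over `F`. -/
def IsTwist {F E : Type*} [Field F] [Field E] [Algebra F E]
    {V W : Type*} [AddCommGroup V] [Module E V] [AddCommGroup W] [Module E W]
    (γ : E ≃ₐ[F] E) (ρ : Representation E M V) (ρ' : Representation E M W) : Prop :=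
  ∃ e : V ≃+ W, (∀ (c : E) (v : V), e (c • v) = γ c • e v) ∧
    ∀ (g : M) (v : V), e (ρ g v) = ρ' g (e v)

/-- Two `E`-representations are Galois conjugate over `F`. -/
def IsGaloisConj (F : Type*) {E : Type*} [Field F] [Field E] [Algebra F E]
    {V W : Type*} [AddCommGroup V] [Module E V] [AddCommGroup W] [Module E W]
    (ρ : Representation E M V) (ρ' : Representation E M W) : Prop :=
  ∃ γ : E ≃ₐ[F] E, IsTwist γ ρ ρ'

/-- The canonical embedding of the group algebra of a subgroup into the group algebra
of the ambient group. -/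
noncomputable def algEmb (k : Type*) [Field k] {G : Type*} [Group G] (H : Subgroup G) :
    MonoidAlgebra k H →ₐ[k] MonoidAlgebra k G :=
  MonoidAlgebra.mapDomainAlgHom k k H.subtype

end Defs

section Helpers

variable {F : Type*} [Field F] {G : Type*} [Group G]

/-- The grading coaction `g ↦ (gH) ⊗ g` of the group algebra by the quotient group. -/
noncomputable def gradeHom (F : Type*) [Field F] {G : Type*} [Group G] (H : Subgroup G)
    [H.Normal] : MonoidAlgebra F G →ₐ[F] MonoidAlgebra (MonoidAlgebra F G) (G ⧸ H) :=
  MonoidAlgebra.lift F _ G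
    { toFun := fun g => MonoidAlgebra.single (g : G ⧸ H) (MonoidAlgebra.single g (1 : F))
      map_one' := by rw [QuotientGroup.mk_one]; rfl
      map_mul' := fun a b => by
        rw [MonoidAlgebra.single_mul_single, MonoidAlgebra.single_mul_single, one_mul,
          QuotientGroup.mk_mul] }

lemma gradeHom_single (H : Subgroup G) [H.Normal] (g : G) (r : F) :
    gradeHom F H (MonoidAlgebra.single g r)
      = MonoidAlgebra.single (g : G ⧸ H) (MonoidAlgebra.single g r) := by
  simp [gradeHom, MonoidAlgebra.lift_single, MonoidAlgebra.smul_single]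

lemma algEmb_single (H : Subgroup G) (h : H) (r : F) :
    algEmb F H (MonoidAlgebra.single h r) = MonoidAlgebra.single (h : G) r := by
  simp [algEmb, MonoidAlgebra.mapDomainAlgHom]

lemma algEmb_inj (H : Subgroup G) : Function.Injective (algEmb F H) :=
  MonoidAlgebra.mapDomain_injective (R := F) (f := H.subtype) H.subtype_injective

lemma gradeHom_algEmb (H : Subgroup G) [H.Normal] (a : MonoidAlgebra F H) :
    gradeHom F H (algEmb F H a) = MonoidAlgebra.single 1 (algEmb F H a) := by
  induction a using MonoidAlgebra.induction_linear with
  | zero => simp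
  | add a b ha hb => rw [map_add, map_add, ha, hb, MonoidAlgebra.single_add]
  | single h r =>
    rw [algEmb_single, gradeHom_single, (QuotientGroup.eq_one_iff (h : G)).2 h.2]

lemma coeff_one_mem_range (H : Subgroup G) [H.Normal] (y : MonoidAlgebra F G) :
    ∃ a, algEmb F H a = (gradeHom F H y).coeff 1 := by
  classical
  induction y using MonoidAlgebra.induction_linear with
  | zero => exact ⟨0, by simp⟩
  | add a b ha hb =>
    obtain ⟨a', ha'⟩ := ha
    obtain ⟨b', hb'⟩ := hb
    exact ⟨a' + b', by simp [ha', hb']⟩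
  | single g r =>
    rw [gradeHom_single, MonoidAlgebra.coeff_single_apply]
    by_cases h : (g : G ⧸ H) = 1
    · rw [if_pos h]
      exact ⟨MonoidAlgebra.single ⟨g, (QuotientGroup.eq_one_iff g).1 h⟩ r, by
        rw [algEmb_single]⟩
    · rw [if_neg h]
      exact ⟨0, by simp⟩

lemma mem_range_of_degree_one (H : Subgroup G) [H.Normal] (y : MonoidAlgebra F G)
    (hy : gradeHom F H y = MonoidAlgebra.single 1 y) : ∃ a, algEmb F H a = y := by
  obtain ⟨a, ha⟩ := coeff_one_mem_range H y
  refine ⟨a, ?_⟩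
  rw [ha, hy]
  simp

lemma classSum_central [Fintype G] (x : G) :
    classSum F x ∈ Set.center (MonoidAlgebra F G) := by
  classical
  rw [Semigroup.mem_center_iff]
  intro y
  induction y using MonoidAlgebra.induction_linear with
  | zero => simp
  | add a b ha hb => rw [add_mul, mul_add, ha, hb]
  | single g r =>
    unfold classSum
    rw [Finset.mul_sum, Finset.sum_mul]
    refine Fintype.sum_equiv (MulAut.conj g).toEquiv _ _ ?_
    intro k
    have hk : IsConj x (g * k * g⁻¹) ↔ IsConj x k := by
      have : IsConj k (g * k * g⁻¹) := isConj_iff.2 ⟨g, rfl⟩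
      exact ⟨fun h => h.trans this.symm, fun h => h.trans this⟩
    simp only [MulEquiv.toEquiv_eq_coe, MulEquiv.coe_toEquiv, MulAut.conj_apply, hk]
    split_ifs
    · simp [MonoidAlgebra.single_mul_single]
    · simp

lemma gradeHom_classSum [Fintype G] (H : Subgroup G) [H.Normal] (x : G)
    (hx : Subgroup.zpowers ((x : G ⧸ H)) = ⊤) :
    gradeHom F H (classSum F x) = MonoidAlgebra.single (x : G ⧸ H) (classSum F x) := by
  classical
  unfold classSum
  have hs : ∀ (q : G ⧸ H) (f : G → MonoidAlgebra F G),
      MonoidAlgebra.single q (∑ g, f g) = ∑ g, MonoidAlgebra.single q (f g) := by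
    intro q f
    exact map_sum (MonoidAlgebra.singleAddHom q) f Finset.univ
  rw [map_sum, hs]
  refine Finset.sum_congr rfl fun g _ => ?_
  split_ifs with h
  · rw [gradeHom_single]
    congr 1
    obtain ⟨k, hk⟩ := isConj_iff.1 h
    have hmem : (k : G ⧸ H) ∈ Subgroup.zpowers ((x : G ⧸ H)) := by rw [hx]; trivial
    obtain ⟨n, hn⟩ := Subgroup.mem_zpowers_iff.1 hmem
    rw [← hk, QuotientGroup.mk_mul, QuotientGroup.mk_mul, QuotientGroup.mk_inv, ← hn]
    group
  · simp

/-- Two nested-comparable primitive central idempotents with nonzero product coincide. -/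
lemma prim_eq {R : Type*} [Ring R] {e f : R} (he : IsPrimCentralIdem e)
    (hf : IsPrimCentralIdem f) (h : e * f ≠ 0) : e = f := by
  obtain ⟨-, hei, hec, hep⟩ := he
  obtain ⟨-, hfi, hfc, hfp⟩ := hf
  have hcomm : e * f = f * e := (Semigroup.mem_center_iff.1 hfc e)
  have hc : e * f ∈ Set.center R := Set.mul_mem_center hec hfc
  have hi : IsIdempotentElem (e * f) := IsIdempotentElem.mul_of_commute hcomm hei hfi
  have h1 := (hep (e * f) hc hi (by rw [hcomm, mul_assoc, hei.eq])).resolve_left h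
  have h2 := (hfp (e * f) hc hi (by rw [mul_assoc, hfi.eq])).resolve_left h
  rw [← h1, h2]

/-- The candidate idempotent attached to a `p`-th root of unity `w`. -/
noncomputable def bermanIdem (p : ℕ) {R : Type*} [Ring R] [Algebra F R] (c e : R) (w : F) : R :=
  (p : F)⁻¹ • ((∑ j ∈ Finset.range p, (w • c) ^ j) * e)

section abstract_part
variable {R : Type*} [Ring R] [Algebra F R] {p : ℕ} {c e : R} {w : F}

lemma berman_mul_e (hee : e * e = e) : bermanIdem p c e w * e = bermanIdem p c e w := by
  unfold bermanIdem
  rw [smul_mul_assoc, mul_assoc, hee]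

lemma berman_eig (hw : w ^ p = 1) (hcp : c ^ p * e = e) :
    (w • c) * bermanIdem p c e w = bermanIdem p c e w := by
  unfold bermanIdem
  rw [mul_smul_comm]
  congr 1
  rw [← sub_eq_zero, ← mul_assoc, ← sub_mul]
  have h := mul_geom_sum (w • c) p
  rw [sub_mul, one_mul] at h
  rw [h, smul_pow, hw, one_smul, sub_mul, hcp, one_mul, sub_self]

lemma berman_eig_pow (hw : w ^ p = 1) (hcp : c ^ p * e = e) (n : ℕ) :
    (w • c) ^ n * bermanIdem p c e w = bermanIdem p c e w := by
  induction n with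
  | zero => simp
  | succ n ih => rw [pow_succ, mul_assoc, berman_eig hw hcp, ih]

lemma berman_central (hc : c ∈ Set.center R) (he : e ∈ Set.center R) :
    bermanIdem p c e w ∈ Set.center R := by
  have hc' : c ∈ Subalgebra.center F R := hc
  have he' : e ∈ Subalgebra.center F R := he
  change _ ∈ Subalgebra.center F R
  exact Subalgebra.smul_mem _ (mul_mem (sum_mem fun j _ => pow_mem (Subalgebra.smul_mem _ hc' _) _) he') _

lemma berman_idem (hp : (p : F) ≠ 0) (hw : w ^ p = 1) (hcp : c ^ p * e = e)
    (he : e ∈ Set.center R) (hee : e * e = e) :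
    bermanIdem p c e w * bermanIdem p c e w = bermanIdem p c e w := by
  have hcomm : e * bermanIdem p c e w = bermanIdem p c e w := by
    rw [← Semigroup.mem_center_iff.1 he, berman_mul_e hee]
  conv_lhs => rw [bermanIdem]
  change ((p : F)⁻¹ • ((∑ j ∈ Finset.range p, (w • c) ^ j) * e)) * bermanIdem p c e w = _
  rw [smul_mul_assoc, mul_assoc, hcomm, Finset.sum_mul,
    Finset.sum_congr rfl fun j _ => berman_eig_pow hw hcp j, Finset.sum_const, Finset.card_range,
    ← Nat.cast_smul_eq_nsmul F, smul_smul, inv_mul_cancel₀ hp, one_smul]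

lemma berman_sum (hp : p.Prime) (hp0 : (p : F) ≠ 0) {zeta : F} (hz : IsPrimitiveRoot zeta p) :
    ∑ i : Fin p, bermanIdem p c e (zeta ^ (i : ℕ)) = e := by
  unfold bermanIdem
  rw [← Finset.smul_sum, ← Finset.sum_mul, Finset.sum_comm]
  have h : ∀ j ∈ Finset.range p, ∑ i : Fin p, (zeta ^ (i : ℕ) • c) ^ j
      = if j = 0 then (p : F) • (1 : R) else 0 := by
    intro j hj
    split_ifs with h0
    · subst h0
      simp [Algebra.smul_def]
    · have hcop : j.Coprime p :=
        ((Nat.Prime.coprime_iff_not_dvd hp).2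
          (Nat.not_dvd_of_pos_of_lt (Nat.pos_of_ne_zero h0) (Finset.mem_range.1 hj))).symm
      have := (hz.pow_of_coprime j hcop).geom_sum_eq_zero hp.one_lt
      simp only [smul_pow]
      rw [← Finset.sum_smul]
      rw [← Fin.sum_univ_eq_sum_range (fun i => (zeta ^ j) ^ i)] at this
      have h2 : ∑ i : Fin p, (zeta ^ (i : ℕ)) ^ j = 0 := by
        rw [← this]
        exact Finset.sum_congr rfl fun i _ => by rw [← pow_mul, ← pow_mul, mul_comm]
      rw [h2, zero_smul]
  rw [Finset.sum_congr rfl h, Finset.sum_ite_eq' , if_pos (Finset.mem_range.2 hp.pos),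
    smul_mul_assoc, smul_smul, inv_mul_cancel₀ hp0, one_smul, one_mul]

end abstract_part

/-- Transport of intertwining along `algEmb`. -/
lemma intertwine_algEmb {H : Subgroup G} {V W : Type*} [AddCommGroup V] [Module F V]
    [AddCommGroup W] [Module F W] (ρ : Representation F G V) (ρ' : Representation F G W)
    (T : V ≃ₗ[F] W) (hT : ∀ (h : H) v, T (ρ (h : G) v) = ρ' (h : G) (T v))
    (a : MonoidAlgebra F H) (v : V) :
    T (ρ.asAlgebraHom (algEmb F H a) v) = ρ'.asAlgebraHom (algEmb F H a) (T v) := by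
  induction a using MonoidAlgebra.induction_linear with
  | zero => simp
  | add a b ha hb => simp only [map_add, LinearMap.add_apply, ha, hb]
  | single h r =>
    rw [algEmb_single, Representation.asAlgebraHom_single, Representation.asAlgebraHom_single]
    simp [hT]

section graded_part

variable {p : ℕ} {H : Subgroup G} [H.Normal] {e : MonoidAlgebra F H} {c : MonoidAlgebra F G}
  {w : F} {q : G ⧸ H}

lemma gradeHom_pow (hgr : gradeHom F H c = MonoidAlgebra.single q c) (n : ℕ) :
    gradeHom F H (c ^ n) = MonoidAlgebra.single (q ^ n) (c ^ n) := by
  rw [map_pow, hgr, MonoidAlgebra.single_pow]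

/-- The degree-one component of `a * f` is `a e / p`. -/
lemma berman_coeff (hp : 0 < p) (hq : orderOf q = p)
    (hgr : gradeHom F H c = MonoidAlgebra.single q c) (a : MonoidAlgebra F H) :
    (gradeHom F H (algEmb F H a * bermanIdem p c (algEmb F H e) w)).coeff 1
      = (p : F)⁻¹ • algEmb F H (a * e) := by
  classical
  have h1 : algEmb F H a * bermanIdem p c (algEmb F H e) w
      = (p : F)⁻¹ • ∑ j ∈ Finset.range p,
          w ^ j • (algEmb F H a * c ^ j * algEmb F H e) := by
    unfold bermanIdem
    rw [mul_smul_comm, ← mul_assoc, Finset.mul_sum, Finset.sum_mul]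
    congr 1
    refine Finset.sum_congr rfl fun j _ => ?_
    rw [smul_pow, mul_smul_comm, smul_mul_assoc]
  rw [h1, map_smul, map_sum, MonoidAlgebra.coeff_smul, Finsupp.smul_apply, MonoidAlgebra.coeff_sum,
    Finsupp.finset_sum_apply]
  congr 1
  have h2 : ∀ j ∈ Finset.range p,
      (gradeHom F H (w ^ j • (algEmb F H a * c ^ j * algEmb F H e))).coeff 1
        = if j = 0 then algEmb F H (a * e) else 0 := by
    intro j hj
    rw [map_smul, map_mul, map_mul, gradeHom_algEmb, gradeHom_algEmb, gradeHom_pow hgr,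
      MonoidAlgebra.single_mul_single, MonoidAlgebra.single_mul_single, one_mul, mul_one,
      MonoidAlgebra.coeff_smul, Finsupp.smul_apply, MonoidAlgebra.coeff_single_apply]
    by_cases h0 : j = 0
    · subst h0
      simp
    · have : q ^ j ≠ 1 := by
        intro h
        exact Nat.not_le_of_lt (Finset.mem_range.1 hj)
          (hq ▸ orderOf_le_of_pow_eq_one (Nat.pos_of_ne_zero h0) h)
      rw [if_neg this, if_neg h0, smul_zero]
  rw [Finset.sum_congr rfl h2, Finset.sum_ite_eq', if_pos (Finset.mem_range.2 hp)]

lemma berman_inj (hp : 0 < p) (hp0 : (p : F) ≠ 0) (hq : orderOf q = p)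
    (hgr : gradeHom F H c = MonoidAlgebra.single q c) (a : MonoidAlgebra F H)
    (h : algEmb F H a * bermanIdem p c (algEmb F H e) w = 0) : a * e = 0 := by
  have h1 := berman_coeff (e := e) (w := w) hp hq hgr a
  rw [h, map_zero] at h1
  have h2 : algEmb F H (a * e) = 0 := by
    have := h1.symm
    simpa [hp0] using this
  exact algEmb_inj H (by rw [h2, map_zero])

lemma berman_surj (hw : w ^ p = 1) (hp : 0 < p) (hcc : c ∈ Set.center (MonoidAlgebra F G))
    (hcp : c ^ p * algEmb F H e = algEmb F H e) (hq : orderOf q = p)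
    (htop : Subgroup.zpowers q = ⊤)
    (hgr : gradeHom F H c = MonoidAlgebra.single q c) (y : MonoidAlgebra F G) :
    ∃ a, y * bermanIdem p c (algEmb F H e) w
      = algEmb F H a * bermanIdem p c (algEmb F H e) w := by
  induction y using MonoidAlgebra.induction_linear with
  | zero => exact ⟨0, by simp⟩
  | add a b ha hb =>
    obtain ⟨a', ha'⟩ := ha
    obtain ⟨b', hb'⟩ := hb
    exact ⟨a' + b', by rw [add_mul, ha', hb', map_add, add_mul]⟩
  | single g r =>
    have hfin : IsOfFinOrder q := orderOf_pos_iff.1 (hq ▸ hp)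
    have hmem : (g : G ⧸ H)⁻¹ ∈ Subgroup.zpowers q := by rw [htop]; trivial
    rw [← hfin.mem_powers_iff_mem_zpowers] at hmem
    obtain ⟨n, hn⟩ := hmem
    have hn' : q ^ n = (g : G ⧸ H)⁻¹ := hn
    have hdeg : gradeHom F H ((w • c) ^ n * MonoidAlgebra.single g r)
        = MonoidAlgebra.single 1 ((w • c) ^ n * MonoidAlgebra.single g r) := by
      rw [smul_pow, smul_mul_assoc, map_smul, map_mul, gradeHom_pow hgr, gradeHom_single,
        MonoidAlgebra.single_mul_single, hn', inv_mul_cancel, MonoidAlgebra.smul_single]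
    obtain ⟨a, ha⟩ := mem_range_of_degree_one H _ hdeg
    refine ⟨a, ?_⟩
    have hcn : (w • c) ^ n ∈ Set.center (MonoidAlgebra F G) := by
      have hc' : c ∈ Subalgebra.center F (MonoidAlgebra F G) := hcc
      change _ ∈ Subalgebra.center F (MonoidAlgebra F G)
      exact pow_mem (Subalgebra.smul_mem _ hc' _) _
    rw [ha, ← Semigroup.mem_center_iff.1 hcn, mul_assoc, berman_eig_pow hw hcp]

lemma berman_prim (hw : w ^ p = 1) (hp : 0 < p) (hp0 : (p : F) ≠ 0)
    (hcc : c ∈ Set.center (MonoidAlgebra F G))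
    (hcent : algEmb F H e ∈ Set.center (MonoidAlgebra F G))
    (he : IsPrimCentralIdem e)
    (hcp : c ^ p * algEmb F H e = algEmb F H e) (hq : orderOf q = p)
    (htop : Subgroup.zpowers q = ⊤)
    (hgr : gradeHom F H c = MonoidAlgebra.single q c) :
    IsPrimCentralIdem (bermanIdem p c (algEmb F H e) w) := by
  obtain ⟨he0, hei, hec, hep⟩ := he
  have hee : algEmb F H e * algEmb F H e = algEmb F H e := by rw [← map_mul, hei.eq]
  have hidem := berman_idem (w := w) hp0 hw hcp hcent hee
  have hfc := berman_central (p := p) (w := w) hcc hcent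
  have hef : algEmb F H e * bermanIdem p c (algEmb F H e) w = bermanIdem p c (algEmb F H e) w := by
    rw [← Semigroup.mem_center_iff.1 hcent, berman_mul_e hee]
  have hinj := fun a => berman_inj (e := e) (w := w) hp hp0 hq hgr a
  have hsurj := fun y => berman_surj (e := e) (w := w) hw hp hcc hcp hq htop hgr y
  generalize bermanIdem p c (algEmb F H e) w = f at *
  refine ⟨?_, hidem, hfc, ?_⟩
  · intro h0
    have := hinj e (by rw [h0, mul_zero])
    rw [hei.eq] at this
    exact he0 this
  · intro z hz hzi hzf
    obtain ⟨a0, ha0⟩ := hsurj z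
    rw [hzf] at ha0
    have hec' : ∀ b, b * e = e * b := Semigroup.mem_center_iff.1 hec
    have hfc' : ∀ b, b * f = f * b := Semigroup.mem_center_iff.1 hfc
    have hz' : ∀ b, b * z = z * b := Semigroup.mem_center_iff.1 hz
    obtain ⟨a, hae, haz⟩ : ∃ a, a * e = a ∧ z = algEmb F H a * f :=
      ⟨a0 * e, by rw [mul_assoc, hei.eq], by rw [map_mul, mul_assoc, hef, ha0]⟩
    have hac : ∀ b, b * a = a * b := by
      intro b
      have h1 : algEmb F H (b * a - a * b) * f = 0 := by
        have h2 := hz' (algEmb F H b)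
        rw [haz] at h2
        rw [map_sub, map_mul, map_mul, sub_mul, sub_eq_zero, mul_assoc, h2, mul_assoc, mul_assoc,
          hfc']
      have h3 := hinj _ h1
      rw [sub_mul, mul_assoc, mul_assoc, hae, hec' b, ← mul_assoc, hae, sub_eq_zero] at h3
      exact h3
    have hai : a * a = a := by
      have h1 : algEmb F H (a * a - a) * f = 0 := by
        have h2 := hzi.eq
        rw [haz] at h2
        rw [map_sub, map_mul, sub_mul, sub_eq_zero]
        calc algEmb F H a * algEmb F H a * f
            = algEmb F H a * algEmb F H a * (f * f) := by rw [hidem]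
          _ = algEmb F H a * (algEmb F H a * f) * f := by simp only [mul_assoc]
          _ = algEmb F H a * (f * algEmb F H a) * f := by rw [hfc' (algEmb F H a)]
          _ = algEmb F H a * f * (algEmb F H a * f) := by simp only [mul_assoc]
          _ = _ := h2
      have h3 := hinj _ h1
      rw [sub_mul, mul_assoc, hae, sub_eq_zero] at h3
      exact h3
    rcases hep a (Semigroup.mem_center_iff.2 hac) hai hae with h | h
    · left
      rw [haz, h, map_zero, zero_mul]
    · right
      rw [haz, h, hef]

end graded_part

end Helpers



/-- Berman's formula: if `e_η` is central in `F[G]`, with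
`(C̄(x))^p e_η = λ e_η`, `μ^p = λ` and `c = C̄(x) e_η / μ`, then after suitable indexing the
primitive central idempotents of the `p` irreducible extensions `ρ_0, …, ρ_{p-1}` of `η` are
`e_{ρ_i} = (1/p)(∑_j ζ^{ij} c^j) e_η`, and `e_η = e_{ρ_0} + ⋯ + e_{ρ_{p-1}}`. -/
theorem stmt_3 {F : Type*} [Field F] [IsAlgClosed F] {G : Type*} [Group G] [Fintype G]
    (hchar : CharZero F ∨ Nat.Coprime (ringChar F) (Fintype.card G))
    (p : ℕ) (hp : p.Prime) (H : Subgroup G) [hH : H.Normal] (hidx : H.index = p)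
    (x : G) (hx : Subgroup.zpowers ((x : G ⧸ H)) = ⊤)
    {V : Type*} [AddCommGroup V] [Module F V]
    (η : Representation F H V) (hirr : RepIrred η)
    (e : MonoidAlgebra F H) (he : IsIdemFor η e)
    (hcent : algEmb F H e ∈ Set.center (MonoidAlgebra F G))
    (lam : F) (hlam : lam ≠ 0)
    (hcl : classSum F x ^ p * algEmb F H e = lam • algEmb F H e)
    (mu : F) (hmu : mu ^ p = lam)
    (c : MonoidAlgebra F G) (hc : c = mu⁻¹ • (classSum F x * algEmb F H e))
    (zeta : F) (hzeta : IsPrimitiveRoot zeta p)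
    (ρ : Fin p → Representation F G V)
    (hρirr : ∀ i, RepIrred (ρ i))
    (hρext : ∀ i, RepIso η ((ρ i).comp H.subtype))
    (hρdist : ∀ i j, i ≠ j → ¬ RepIso (ρ i) (ρ j))
    (E : Fin p → MonoidAlgebra F G) (hE : ∀ i, IsIdemFor (ρ i) (E i)) :
    (∃ σ : Equiv.Perm (Fin p), ∀ i : Fin p,
      E (σ i) = (p : F)⁻¹ •
        ((∑ j ∈ Finset.range p, zeta ^ ((i : ℕ) * j) • c ^ j) * algEmb F H e)) ∧
    algEmb F H e = ∑ i : Fin p, E i := by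
  have hp0 : (p : F) ≠ 0 := by
    haveI : NeZero p := ⟨hp.ne_zero⟩
    exact hzeta.neZero'.out
  have hmu0 : mu ≠ 0 := by
    rintro rfl
    rw [zero_pow hp.ne_zero] at hmu
    exact hlam hmu.symm
  have hei := he.1.2.1
  have hee : algEmb F H e * algEmb F H e = algEmb F H e := by rw [← map_mul, hei.eq]
  have hcc : c ∈ Set.center (MonoidAlgebra F G) := by
    have h1 : classSum F x * algEmb F H e ∈ Subalgebra.center F (MonoidAlgebra F G) :=
      Set.mul_mem_center (classSum_central x) hcent
    rw [hc]
    exact Subalgebra.smul_mem _ h1 _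
  have hcp : c ^ p * algEmb F H e = algEmb F H e := by
    have hcomm : Commute (classSum F x) (algEmb F H e) := Semigroup.mem_center_iff.1 hcent _
    have hidp : algEmb F H e ^ p = algEmb F H e :=
      IsIdempotentElem.pow_eq hee hp.ne_zero
    rw [hc, smul_pow, hcomm.mul_pow, hidp, smul_mul_assoc, mul_assoc, hee, hcl, smul_smul, inv_pow,
      hmu, inv_mul_cancel₀ hlam, one_smul]
  have hq : orderOf (x : G ⧸ H) = p := by
    rw [← Nat.card_zpowers, hx, Subgroup.card_top, ← hidx]
    rfl
  have hgr : gradeHom F H c = MonoidAlgebra.single (x : G ⧸ H) c := by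
    rw [hc, map_smul, map_mul, gradeHom_classSum H x hx, gradeHom_algEmb,
      MonoidAlgebra.single_mul_single, mul_one, MonoidAlgebra.smul_single]
  have hw : ∀ i : ℕ, (zeta ^ i) ^ p = 1 := fun i => by
    rw [← pow_mul, mul_comm, pow_mul, hzeta.pow_eq_one, one_pow]
  set f : Fin p → MonoidAlgebra F G := fun i => bermanIdem p c (algEmb F H e) (zeta ^ (i : ℕ))
    with hf
  have hfprim : ∀ i, IsPrimCentralIdem (f i) := fun i =>
    berman_prim (hw i) hp.pos hp0 hcc hcent he.1 hcp hq hx hgr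
  have hfsum : ∑ i, f i = algEmb F H e := berman_sum hp hp0 hzeta
  have hfsurj : ∀ (i : Fin p) (y : MonoidAlgebra F G), ∃ a, y * f i = algEmb F H a * f i :=
    fun i y => berman_surj (hw i) hp.pos hcc hcp hq hx hgr y
  -- each `E k` is one of the `f i`
  have hρe : ∀ k, (ρ k).asAlgebraHom (algEmb F H e) = 1 := by
    intro k
    obtain ⟨T, hT⟩ := hρext k
    have key : ∀ (a : MonoidAlgebra F H) (v : V),
        T (η.asAlgebraHom a v) = (ρ k).asAlgebraHom (algEmb F H a) (T v) := by
      intro a v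
      induction a using MonoidAlgebra.induction_linear with
      | zero => simp
      | add a b ha hb => simp only [map_add, LinearMap.add_apply, ha, hb]
      | single h r =>
        rw [algEmb_single, Representation.asAlgebraHom_single, Representation.asAlgebraHom_single]
        have := hT h v
        simp only [LinearMap.smul_apply, map_smul, this]
        rfl
    ext v
    have h1 := key e (T.symm v)
    rw [he.2] at h1
    simpa using h1.symm
  have hex : ∀ k, ∃ i, E k = f i := by
    intro k
    by_contra hno
    push Not at hno
    have h0 : ∀ i, E k * f i = 0 := by
      intro i
      by_contra hne
      exact hno i (prim_eq (hE k).1 (hfprim i) hne)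
    have h1 : E k * algEmb F H e = 0 := by
      rw [← hfsum, Finset.mul_sum]
      exact Finset.sum_eq_zero fun i _ => h0 i
    have h2 := congrArg (ρ k).asAlgebraHom h1
    rw [map_mul, (hE k).2, hρe, map_zero, mul_one] at h2
    haveI : Nontrivial V := hirr.1
    exact one_ne_zero h2
  choose τ hτ using hex
  have hτinj : Function.Injective τ := by
    intro k l hkl
    by_contra hne
    apply hρdist k l hne
    obtain ⟨T, hT⟩ := hρext k
    obtain ⟨S, hS⟩ := hρext l
    refine ⟨T.symm.trans S, ?_⟩
    have hTS : ∀ (h : H) v, (T.symm.trans S) (ρ k (h : G) v) = ρ l (h : G) ((T.symm.trans S) v) := by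
      intro h v
      have h1 : ρ k (h : G) v = T (η h (T.symm v)) := by
        rw [hT h (T.symm v), LinearEquiv.apply_symm_apply]
        rfl
      rw [h1, LinearEquiv.trans_apply, LinearEquiv.symm_apply_apply, hS]
      rfl
    intro g v
    obtain ⟨a, ha⟩ := hfsurj (τ k) (MonoidAlgebra.single g 1)
    have hk : ρ k g = (ρ k).asAlgebraHom (algEmb F H a) := by
      have := congrArg (ρ k).asAlgebraHom ha
      rw [map_mul, map_mul, ← hτ k, (hE k).2, Representation.asAlgebraHom_single_one, mul_one,
        mul_one] at this
      exact this
    have hl : ρ l g = (ρ l).asAlgebraHom (algEmb F H a) := by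
      have := congrArg (ρ l).asAlgebraHom ha
      rw [map_mul, map_mul, hkl, ← hτ l, (hE l).2, Representation.asAlgebraHom_single_one, mul_one,
        mul_one] at this
      exact this
    rw [hk, hl]
    exact intertwine_algEmb (ρ k) (ρ l) (T.symm.trans S) hTS a v
  have hτbij : Function.Bijective τ := Finite.injective_iff_bijective.1 hτinj
  refine ⟨⟨(Equiv.ofBijective τ hτbij).symm, fun i => ?_⟩, ?_⟩
  · rw [hτ, ← Equiv.ofBijective_apply τ hτbij, Equiv.apply_symm_apply]
    simp only [hf, bermanIdem, smul_pow, pow_mul]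
  · rw [← hfsum, ← (Equiv.ofBijective τ hτbij).sum_comp]
    exact Finset.sum_congr rfl fun k _ => (hτ k).symm
end

section
/- Let G be a finite group, H a normal subgroup of prime index p, x in G a lift of a generator of G/H, and F a field of characteristic 0 or coprime to |G| with algebraic closure F̄. Let η be an irreducible F-representation of H with η ≅ η^x, and write η ⊗_F F̄ ≅ m(η_1 ⊕ η_2 ⊕ … ⊕ η_k), where the η_i are pairwise inequivalent Galois-conjugate irreducible F̄-representations of H and m is their common Schur index over F. If η_i is not equivalent to η_i^x for all i, 1 ≤ i ≤ k, then η↑_H^G is equivalent to a direct sum of copies of a single irreducible F-representation of G. -/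
open scoped TensorProduct

section Helpers

theorem aux_density {R M : Type*} [Ring R] [AddCommGroup M] [Module R M] [IsSemisimpleModule R M]
    (π : M →ₗ[R] M) (hπ : ∀ q : M →ₗ[R] M, ∀ v, π (q v) = q (π v))
    {n : ℕ} (v : Fin n → M) : ∃ f : R, ∀ i, f • v i = π (v i) := by
  obtain ⟨C, hC⟩ := exists_isCompl (Submodule.span R {v})
  obtain ⟨q, hq⟩ : ∃ q : (Fin n → M) →ₗ[R] (Fin n → M),
      (∀ y, q y ∈ Submodule.span R {v}) ∧ q v = v := by
    refine ⟨(Submodule.span R {v}).subtype ∘ₗ Submodule.projectionOnto _ _ hC, fun y => by simp, ?_⟩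
    simp
  have key : ∀ w : Fin n → M, q (fun i => π (w i)) = fun i => π (q w i) := by
    intro w
    have h1 : ∀ w : Fin n → M, q w = ∑ i, q (Pi.single i (w i)) := by
      intro w
      rw [← map_sum, Finset.univ_sum_single]
    rw [h1, h1 w]
    ext j
    simp only [Finset.sum_apply, map_sum]
    refine Finset.sum_congr rfl fun i _ => ?_
    exact (hπ (LinearMap.proj j ∘ₗ q ∘ₗ LinearMap.single R (fun _ => M) i) (w i)).symm
  have h2 := hq.1 (fun i => π (v i))
  rw [key, hq.2] at h2
  obtain ⟨f, hf⟩ := Submodule.mem_span_singleton.1 h2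
  exact ⟨f, fun i => congrFun hf i⟩

theorem aux_proj {R M : Type*} [Ring R] [AddCommGroup M] [Module R M] [IsSemisimpleModule R M]
    (N : Submodule R M) (hN : N.IsFullyInvariant) :
    ∃ π : M →ₗ[R] M, (∀ q : M →ₗ[R] M, ∀ v, π (q v) = q (π v)) ∧
      (∀ v, π v ∈ N) ∧ ∀ v ∈ N, π v = v := by
  obtain ⟨N', hN', hc⟩ : ∃ N' : Submodule R M, N'.IsFullyInvariant ∧ IsCompl N N' := by
    let o := OrderIso.setIsotypicComponents (R := R) (M := M)
    have h := o.isCompl (isCompl_compl (x := o.symm ⟨N, hN⟩))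
    rw [OrderIso.apply_symm_apply] at h
    refine ⟨_, (o (o.symm ⟨N, hN⟩)ᶜ).2, ?_⟩
    have hi := h.inf_eq_bot
    have hs := h.sup_eq_top
    exact IsCompl.of_eq (congrArg Subtype.val hi) (congrArg Subtype.val hs)
  have hl : ∀ v ∈ N, (N.subtype ∘ₗ N.projectionOnto N' hc) v = v := fun v hv => by
    simpa using congrArg Subtype.val (Submodule.projectionOnto_apply_left hc ⟨v, hv⟩)
  have hr : ∀ v ∈ N', (N.subtype ∘ₗ N.projectionOnto N' hc) v = 0 := fun v hv => by
    simpa using congrArg Subtype.val (Submodule.projectionOnto_apply_right hc ⟨v, hv⟩)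
  refine ⟨N.subtype ∘ₗ N.projectionOnto N' hc, fun q v => ?_, fun v => by simp, hl⟩
  obtain ⟨a, ha, b, hb, rfl⟩ := Submodule.mem_sup.1 (hc.sup_eq_top ▸ Submodule.mem_top (x := v))
  rw [map_add, map_add, map_add, hl a ha, hr b hb, hl _ (hN q ha), hr _ (hN' q hb), map_add,
    map_zero]

theorem aux_isotypic {F R M : Type*} [Field F] [Ring R] [Algebra F R] [AddCommGroup M]
    [Module F M] [Module R M] [IsScalarTower F R M] [Module.Finite F M] [IsSemisimpleModule R M]
    (h : ∀ f : R, (∀ (r : R) (v : M), f • r • v = r • f • v) → (∀ v : M, f • f • v = f • v) →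
      (∀ v : M, f • v = 0) ∨ (∀ v : M, f • v = v)) : IsIsotypic R M := by
  rw [isIsotypic_iff_isFullyInvariant_imp_bot_or_top]
  intro N hN
  obtain ⟨π, hπ, hm, hi⟩ := aux_proj N hN
  obtain ⟨n, s, hs⟩ := Module.Finite.exists_fin (R := F) (M := M)
  obtain ⟨f, hf⟩ := aux_density π hπ s
  have hf' : ∀ v, f • v = π v := by
    intro v
    have hv : v ∈ Submodule.span F (Set.range s) := hs ▸ Submodule.mem_top
    induction hv using Submodule.span_induction with
    | mem y hy => obtain ⟨i, rfl⟩ := hy; exact hf i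
    | zero => simp
    | add a b _ _ ha hb => rw [smul_add, ha, hb, map_add]
    | smul c a _ ha =>
      rw [← algebraMap_smul R c a, map_smul, ← ha, ← mul_smul, ← mul_smul, Algebra.commutes]
  rcases h f (fun r v => by rw [hf', hf', map_smul])
    (fun v => by rw [hf', hf', hi _ (hm v)]) with h | h
  · left
    rw [eq_bot_iff]
    intro v hv
    rw [Submodule.mem_bot, ← h v, hf', hi v hv]
  · right
    rw [eq_top_iff]
    intro v _
    rw [← h v, hf']
    exact hm v

theorem aux_decomp {R M : Type*} [Ring R] [AddCommGroup M] [Module R M] [IsSemisimpleModule R M]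
    [Module.Finite R M] (h : IsIsotypic R M) :
    ∃ (n : ℕ) (S : Fin n → Submodule R M), iSupIndep S ∧ iSup S = ⊤ ∧
      (∀ j, IsSimpleModule R (S j)) ∧ ∀ j j', Nonempty (S j ≃ₗ[R] S j') := by
  obtain ⟨s, hind, hsup, hsimp⟩ := IsSemisimpleModule.exists_sSupIndep_sSup_simples_eq_top R M
  have hfin : Finite s := WellFoundedGT.finite_of_sSupIndep hind
  obtain ⟨n, ⟨e⟩⟩ := Finite.exists_equiv_fin s
  have hs : ∀ j, IsSimpleModule R ((e.symm j : Submodule R M)) := fun j => hsimp _ (e.symm j).2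
  refine ⟨n, fun j => (e.symm j : Submodule R M), ?_, ?_, hs, fun j j' => ?_⟩
  · exact (sSupIndep_iff s).1 hind |>.comp e.symm.injective
  · rw [← hsup, sSup_eq_iSup']
    exact e.symm.iSup_comp (g := fun a : s => (a : Submodule R M))
  · exact h _ _

end Helpers

section Helpers2

theorem aux_conj {K G U : Type*} [Field K] [Group G] {H : Subgroup G} (hH : H.Normal)
    (hp : H.index.Prime) [AddCommGroup U] [Module K U]
    (σ : Representation K H U) (g x : G) (hg : g ∉ H)
    (hiso : RepIso σ (ConjRep hH g σ)) : RepIso σ (ConjRep hH x σ) := by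
  have hc : ∀ (g : G) (h : H), conjHom hH g h = ⟨g * h * g⁻¹, hH.conj_mem h h.2 g⟩ :=
    fun _ _ => rfl
  let L : Subgroup G :=
    { carrier := {g | RepIso σ (ConjRep hH g σ)}
      one_mem' := ⟨LinearEquiv.refl K U, fun h u => by simp [ConjRep, hc]⟩
      mul_mem' := by
        rintro a b ⟨e, he⟩ ⟨e', he'⟩
        refine ⟨e'.trans e, fun h u => ?_⟩
        simp only [LinearEquiv.trans_apply, ConjRep, MonoidHom.comp_apply] at he he' ⊢
        rw [he', he]
        congr 2
        simp [hc, mul_assoc]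
      inv_mem' := by
        rintro a ⟨e, he⟩
        refine ⟨e.symm, fun h u => ?_⟩
        rw [LinearEquiv.symm_apply_eq]
        simp only [ConjRep, MonoidHom.comp_apply] at he ⊢
        rw [he]
        simp [hc, mul_assoc] }
  have hle : H ≤ L := by
    intro a ha
    refine ⟨LinearEquiv.ofLinearMap (σ ⟨a, ha⟩) (σ (⟨a, ha⟩)⁻¹) ?_ ?_, fun h u => ?_⟩
    · rw [← Module.End.mul_eq_comp, ← map_mul]; simp; rfl
    · rw [← Module.End.mul_eq_comp, ← map_mul]; simp; rfl
    · simp only [LinearEquiv.coe_ofLinearMap, ConjRep, MonoidHom.comp_apply,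
        ← Module.End.mul_apply, ← map_mul]
      congr 2
      ext
      simp [hc, mul_assoc]
  have hmul := Subgroup.relIndex_mul_index hle
  have hd : L.index ∣ H.index := ⟨_, by rw [mul_comm]; exact hmul.symm⟩
  rcases (Nat.dvd_prime hp).1 hd with h1 | h1
  · rw [Subgroup.index_eq_one] at h1
    exact (h1 ▸ Subgroup.mem_top x : x ∈ L)
  · rw [h1] at hmul
    have : H.relIndex L = 1 := by
      have := hp.pos
      nlinarith
    rw [Subgroup.relIndex_eq_one] at this
    exact absurd (this hiso) hg

theorem aux_schur {K G U : Type*} [Field K] [Group G] {H : Subgroup G} (hH : H.Normal)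
    [AddCommGroup U] [Module K U]
    (σ : Representation K H U) (hirr : RepIrred σ) (g : G)
    (hn : ¬ RepIso σ (ConjRep hH g σ)) (T : U →ₗ[K] U)
    (hT : ∀ (h : H) (u : U), T (σ h u) = ConjRep hH g σ h (T u)) : T = 0 := by
  rcases hirr.2 (LinearMap.ker T) (fun h v hv => by
    rw [LinearMap.mem_ker] at hv ⊢; rw [hT, hv, map_zero]) with hk | hk
  · rcases hirr.2 (LinearMap.range T) (fun h v hv => by
      obtain ⟨u, rfl⟩ := hv
      refine ⟨σ (conjHom hH g⁻¹ h) u, ?_⟩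
      rw [hT]
      simp only [ConjRep, MonoidHom.comp_apply]
      congr 2
      ext
      simp [conjHom, mul_assoc]) with hr | hr
    · exact LinearMap.range_eq_bot.1 hr
    · exact absurd ⟨LinearEquiv.ofBijective T ⟨LinearMap.ker_eq_bot.1 hk,
        LinearMap.range_eq_top.1 hr⟩, fun h u => hT h u⟩ hn
  · exact LinearMap.ker_eq_top.1 hk

theorem aux_zero {F E G V : Type*} [Field F] [Field E] [Algebra F E] [Group G] {H : Subgroup G}
    [Fintype H] (hH : H.Normal) [AddCommGroup V] [Module F V] (η : Representation F H V)
    {ι : Type*} {W : ι → Type*} [∀ i, AddCommGroup (W i)] [∀ i, Module E (W i)]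
    (σ : ∀ i, Representation E H (W i)) (hirr : ∀ i, RepIrred (σ i))
    (hdec : RepIso (BaseChangeRep E η) (PiRep σ)) (g : G)
    (hn : ∀ i, ¬ RepIso (σ i) (ConjRep hH g (σ i)))
    (a : H → F) (hT : ∀ (h : H) (v : V),
      ∑ t, a t • η t (η h v) = ConjRep hH g η h (∑ t, a t • η t v)) (v : V) :
    ∑ t, a t • η t v = 0 := by
  classical
  obtain ⟨e, he⟩ := hdec
  have key : ∀ i, ∑ t, (algebraMap F E (a t)) • σ i t = 0 := by
    intro i
    apply aux_schur hH (σ i) (hirr i) g (hn i)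
    intro h u
    -- transported identity
    have h1 : ∀ y : E ⊗[F] V,
        ∑ t, (algebraMap F E (a t)) • BaseChangeRep E η t (BaseChangeRep E η h y) =
        BaseChangeRep E η (conjHom hH g h)
          (∑ t, (algebraMap F E (a t)) • BaseChangeRep E η t y) := by
      intro y
      induction y using TensorProduct.induction_on with
      | zero => simp
      | add y z hy hz =>
        simp only [map_add, smul_add, Finset.sum_add_distrib] at hy hz ⊢
        rw [hy, hz]
      | tmul c w =>
        have h2 := congrArg (fun z => c ⊗ₜ[F] z) (hT h w)
        simp only [ConjRep, MonoidHom.comp_apply, map_sum, map_smul, TensorProduct.tmul_sum,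
          TensorProduct.tmul_smul] at h2
        simpa [BaseChangeRep, algebraMap_smul] using h2
    have h3 := congrArg (fun z => e z i) (h1 (e.symm (Pi.single i u)))
    simpa [he, PiRep, ConjRep, -algebraMap_smul] using h3
  have h4 : ∑ t, (algebraMap F E (a t)) • BaseChangeRep E η t ((1 : E) ⊗ₜ[F] v) = 0 := by
    apply e.injective
    ext i
    have := LinearMap.congr_fun (key i) (e ((1 : E) ⊗ₜ[F] v) i)
    simpa [he, PiRep, -algebraMap_smul] using this
  have h5 : (1 : E) ⊗ₜ[F] (∑ t, a t • η t v) = 0 := by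
    rw [← h4]
    simp [BaseChangeRep, TensorProduct.tmul_sum, TensorProduct.tmul_smul, algebraMap_smul]
  have hinj : Function.Injective (fun v : V => (1 : E) ⊗ₜ[F] v) :=
    Module.FaithfullyFlat.tensorProduct_mk_injective (A := F) (B := E) V
  exact hinj (by simpa using h5)

end Helpers2

section Helpers3

/-- An operator from the group algebra commuting with `G` preserves the image of `η`. -/
theorem aux_pres {F E G V : Type*} [Field F] [Field E] [Algebra F E] [Group G] [Fintype G]
    {H : Subgroup G} (hH : H.Normal) [AddCommGroup V] [Module F V] (η : Representation F H V)
    {ι : Type*} {W : ι → Type*} [∀ i, AddCommGroup (W i)] [∀ i, Module E (W i)]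
    (σ : ∀ i, Representation E H (W i)) (hirr : ∀ i, RepIrred (σ i))
    (hdec : RepIso (BaseChangeRep E η) (PiRep σ))
    (hn : ∀ (g : G), g ∉ H → ∀ i, ¬ RepIso (σ i) (ConjRep hH g (σ i)))
    {M : Type*} [AddCommGroup M] [Module F M] (ρ : Representation F G M)
    (j : V →ₗ[F] M) (hj : Function.Injective j)
    (hjH : ∀ (h : H) (v : V), j (η h v) = ρ (h : G) (j v))
    (S : G ⧸ H → Submodule F M)
    (hS : ∀ g : G, S (g : G ⧸ H) = (LinearMap.range j).map (ρ g)) (hind : iSupIndep S)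
    (f : G → F)
    (hf : ∀ (g : G) (w : M), ∑ t, f t • ρ t (ρ g w) = ρ g (∑ t, f t • ρ t w)) (v : V) :
    ∃ v', ∑ t, f t • ρ t (j v) = j v' := by
  classical
  let T : G → V → V := fun g v => ∑ t : H, f (g * t) • η t v
  have hsum : ∀ v, ∑ t, f t • ρ t (j v) = ∑ c : G ⧸ H, ρ c.out (j (T c.out v)) := by
    intro v
    have hbij : Function.Bijective (fun q : (G ⧸ H) × H => q.1.out * (q.2 : G)) := by
      constructor
      · rintro ⟨c, t⟩ ⟨c', t'⟩ heq
        have heq' : c.out * (t : G) = c'.out * (t' : G) := heq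
        have hc : c = c' := by
          have := congrArg (QuotientGroup.mk (s := H)) heq'
          rwa [QuotientGroup.mk_mul_of_mem _ t.2, QuotientGroup.mk_mul_of_mem _ t'.2,
            QuotientGroup.out_eq', QuotientGroup.out_eq'] at this
        subst hc
        simpa using heq'
      · intro g
        refine ⟨((g : G ⧸ H), ⟨(g : G ⧸ H).out⁻¹ * g, ?_⟩), by simp⟩
        rw [← QuotientGroup.eq, QuotientGroup.out_eq']
    rw [← hbij.sum_comp, Fintype.sum_prod_type]
    refine Finset.sum_congr rfl fun c _ => ?_
    simp only [T, map_sum, map_smul, hjH]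
    refine Finset.sum_congr rfl fun t _ => ?_
    rw [map_mul, Module.End.mul_apply]
  have hcomm : ∀ (c : G ⧸ H) (h : H) (v : V),
      T c.out (η h v) = ConjRep hH (c.out)⁻¹ η h (T c.out v) := by
    intro c h v
    have h1 := hf h (j v)
    rw [← hjH, hsum, hsum, map_sum] at h1
    have h2 : ∀ c : G ⧸ H, ρ h (ρ c.out (j (T c.out v))) =
        ρ c.out (j (ConjRep hH (c.out)⁻¹ η h (T c.out v))) := by
      intro c
      simp only [ConjRep, MonoidHom.comp_apply, hjH, ← Module.End.mul_apply, ← map_mul]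
      congr 2
      simp [conjHom, mul_assoc]
    simp only [h2] at h1
    have hmem : ∀ (c : G ⧸ H) (u : V), ρ c.out (j u) ∈ S c := by
      intro c u
      have := hS c.out
      rw [QuotientGroup.out_eq'] at this
      rw [this]
      exact ⟨j u, ⟨u, rfl⟩, rfl⟩
    have h3 := (iSupIndep_iff_finsetSum_eq_imp_eq S).1 hind Finset.univ
      (fun c => ρ c.out (j (T c.out (η h v))))
      (fun c => ρ c.out (j (ConjRep hH (c.out)⁻¹ η h (T c.out v))))
      (fun c _ => ⟨hmem c _, hmem c _⟩) h1 c (Finset.mem_univ c)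
    have h4 : ρ c.out (j (T c.out (η h v))) =
        ρ c.out (j (ConjRep hH (c.out)⁻¹ η h (T c.out v))) := h3
    have h5 := congrArg (ρ (c.out)⁻¹) h4
    rw [Representation.inv_self_apply, Representation.inv_self_apply] at h5
    exact hj h5
  have hzero : ∀ c : G ⧸ H, c ≠ 1 → ∀ v, T c.out v = 0 := by
    intro c hc v
    refine aux_zero hH η σ hirr hdec (c.out)⁻¹ (hn _ ?_) (fun t => f (c.out * t)) (hcomm c) v
    intro hmem
    apply hc
    rw [← QuotientGroup.out_eq' c, QuotientGroup.eq_one_iff]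
    exact (Subgroup.inv_mem_iff H).1 hmem
  have hone : (1 : G ⧸ H).out ∈ H := by
    rw [← QuotientGroup.eq_one_iff, QuotientGroup.out_eq']
  refine ⟨η ⟨_, hone⟩ (T (1 : G ⧸ H).out v), ?_⟩
  rw [hsum, hjH, Finset.sum_eq_single (1 : G ⧸ H)]
  · intro c _ hc
    rw [hzero c hc, map_zero, map_zero]
  · simp

end Helpers3

section Helpers4

theorem aux_final {F G M : Type*} [Field F] [Group G] [AddCommGroup M] [Module F M]
    (ρ : Representation F G M) [Module (MonoidAlgebra F G) M]
    [IsScalarTower F (MonoidAlgebra F G) M]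
    (hρ : ∀ (g : G) (v : M), (MonoidAlgebra.single g (1 : F)) • v = ρ g v)
    {n : ℕ} (S : Fin n → Submodule (MonoidAlgebra F G) M) (hind : iSupIndep S)
    (hsup : iSup S = ⊤) (hsimp : ∀ j, IsSimpleModule (MonoidAlgebra F G) (S j))
    (hiso : ∀ j j', Nonempty (S j ≃ₗ[MonoidAlgebra F G] S j')) :
    ∃ (n : ℕ) (S : Fin n → Submodule F M)
        (hS : ∀ j, ∀ g : G, ∀ v ∈ S j, ρ g v ∈ S j),
        iSupIndep S ∧ iSup S = ⊤ ∧
        (∀ j, RepIrred (SubRep ρ (S j) (hS j))) ∧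
        (∀ j j', RepIso (SubRep ρ (S j) (hS j)) (SubRep ρ (S j') (hS j'))) := by
  have hst : ∀ (j : Fin n) (g : G), ∀ v ∈ (S j).restrictScalars F,
      ρ g v ∈ (S j).restrictScalars F := by
    intro j g v hv
    rw [← hρ]
    exact (S j).smul_mem _ hv
  refine ⟨n, fun j => (S j).restrictScalars F, hst, ?_, ?_, fun j => ⟨?_, ?_⟩,
    fun j j' => ?_⟩
  · rw [iSupIndep_iff_finsetSum_eq_zero_imp_eq_zero] at hind ⊢
    exact hind
  · rw [← Submodule.restrictScalars_iSup, hsup, Submodule.restrictScalars_top]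
  · exact (IsSimpleModule.nontrivial (MonoidAlgebra F G) (S j))
  · intro U hU
    have hU' : ∀ (r : MonoidAlgebra F G) (v : S j), v ∈ U → r • v ∈ U := by
      intro r v hv
      induction r using MonoidAlgebra.induction_linear with
      | zero => rw [zero_smul]; exact U.zero_mem
      | add a b ha hb => rw [add_smul]; exact U.add_mem ha hb
      | single g a =>
        have h1 : (MonoidAlgebra.single g a : MonoidAlgebra F G) • v =
            a • (SubRep ρ ((S j).restrictScalars F) (hst j) g v) := by
          have : (MonoidAlgebra.single g a : MonoidAlgebra F G) =
            a • MonoidAlgebra.single g (1 : F) := by simp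
          rw [this, smul_assoc]
          congr 1
          exact Subtype.ext (hρ g v)
        rw [h1]
        exact U.smul_mem _ (hU g v hv)
    let U' : Submodule (MonoidAlgebra F G) (S j) :=
      { carrier := {v : S j | v ∈ U}
        add_mem' := U.add_mem
        zero_mem' := U.zero_mem
        smul_mem' := fun r v hv => hU' r v hv }
    have hs := hsimp j
    rcases eq_bot_or_eq_top U' with h | h
    · left
      ext v
      exact (SetLike.ext_iff.1 h v : _)
    · right
      ext v
      exact (SetLike.ext_iff.1 h v : _)
  · obtain ⟨e⟩ := hiso j j'
    refine ⟨e.restrictScalars F, fun g v => ?_⟩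
    apply Subtype.ext
    have h2 : SubRep ρ ((S j).restrictScalars F) (hst j) g v =
      ((MonoidAlgebra.single g (1 : F) • (show S j from v) : S j)) := Subtype.ext (hρ g v).symm
    have h1 := congrArg Subtype.val (e.map_smul (MonoidAlgebra.single g (1 : F)) v)
    exact ((congrArg (fun z : S j => (e z : M)) h2).trans h1).trans (hρ g _)

end Helpers4

/-- If `η ≅ η^x` and, in the decomposition
`η ⊗_F F̄ ≅ m(η_1 ⊕ … ⊕ η_k)`, no `η_i` is equivalent to `η_i^x`, then `η↑_H^G` is a direct
sum of copies of a single irreducible `F`-representation of `G`. -/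
theorem stmt_6 {F : Type*} [Field F] {G : Type*} [Group G] [Fintype G]
    (hchar : CharZero F ∨ Nat.Coprime (ringChar F) (Fintype.card G))
    (p : ℕ) (hp : p.Prime) (H : Subgroup G) [hH : H.Normal] (hidx : H.index = p)
    (x : G) (hx : Subgroup.zpowers ((x : G ⧸ H)) = ⊤)
    {V : Type*} [AddCommGroup V] [Module F V]
    (η : Representation F H V) (hirr : RepIrred η)
    (hself : RepIso η (ConjRep hH x η))
    (k m : ℕ) {W : Fin k → Type*} [∀ i, AddCommGroup (W i)]
    [∀ i, Module (AlgebraicClosure F) (W i)]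
    (ηs : ∀ i, Representation (AlgebraicClosure F) H (W i))
    (hirrs : ∀ i, RepIrred (ηs i))
    (hsdist : ∀ i j, i ≠ j → ¬ RepIso (ηs i) (ηs j))
    (hgal : ∀ i j, IsGaloisConj F (ηs i) (ηs j))
    (hdec : RepIso (BaseChangeRep (AlgebraicClosure F) η)
      (PiRep fun q : Fin m × Fin k => ηs q.2))
    (hnot : ∀ i, ¬ RepIso (ηs i) (ConjRep hH x (ηs i))) :
    ∀ {W' : Type*} [AddCommGroup W'] [Module F W'] (ρ : Representation F G W'),
      IsInducedFrom H η ρ →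
      ∃ (n : ℕ) (S : Fin n → Submodule F W')
        (hS : ∀ j, ∀ g : G, ∀ v ∈ S j, ρ g v ∈ S j),
        iSupIndep S ∧ iSup S = ⊤ ∧
        (∀ j, RepIrred (SubRep ρ (S j) (hS j))) ∧
        (∀ j j', RepIso (SubRep ρ (S j) (hS j)) (SubRep ρ (S j') (hS j'))) := by
  intro W' _ _ ρ hind
  obtain ⟨j, hj, hjH, S, hS, hSi, hSs⟩ := hind
  have hne : NeZero (Nat.card G : F) := by
    refine ⟨?_⟩
    rw [Nat.card_eq_fintype_card]
    rcases hchar with h | h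
    · exact Nat.cast_ne_zero.2 Fintype.card_ne_zero
    · intro h0
      have hd := (ringChar.spec F _).1 h0
      have h1 : ringChar F = 1 := Nat.eq_one_of_dvd_coprimes h dvd_rfl hd
      exact CharP.ringChar_ne_one h1
  have hVfin : Module.Finite F V := by
    have := hirr.1
    obtain ⟨v, hv⟩ := exists_ne (0 : V)
    have hfg : (Submodule.span F (Set.range fun h : H => η h v)).FG :=
      Submodule.fg_span (Set.finite_range _)
    rcases hirr.2 (Submodule.span F (Set.range fun h : H => η h v)) (fun g w hw => by
      induction hw using Submodule.span_induction with
      | mem y hy =>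
        obtain ⟨h, rfl⟩ := hy
        exact Submodule.subset_span ⟨g * h, by simp⟩
      | zero => simp
      | add a b _ _ ha hb => rw [map_add]; exact Submodule.add_mem _ ha hb
      | smul c a _ ha => rw [map_smul]; exact Submodule.smul_mem _ _ ha) with h | h
    · exfalso
      apply hv
      have : v ∈ Submodule.span F (Set.range fun h : H => η h v) :=
        Submodule.subset_span ⟨1, by simp⟩
      rwa [h, Submodule.mem_bot] at this
    · rw [h] at hfg
      exact ⟨hfg⟩
  have hWfin : Module.Finite F W' := by
    refine ⟨?_⟩
    rw [← hSs]
    refine Submodule.fg_iSup _ fun c => ?_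
    obtain ⟨g, rfl⟩ := QuotientGroup.mk_surjective c
    rw [hS, LinearMap.range_eq_map]
    exact (hVfin.1.map _).map _
  let _ : Module (MonoidAlgebra F G) W' := Module.compHom W' ρ.asAlgebraHom.toRingHom
  have hact : ∀ (r : MonoidAlgebra F G) (w : W'), r • w = ρ.asAlgebraHom r w := fun _ _ => rfl
  have hsingle : ∀ (g : G) (w : W'), (MonoidAlgebra.single g (1 : F)) • w = ρ g w := by
    intro g w
    rw [hact]
    simp
  have : IsScalarTower F (MonoidAlgebra F G) W' :=
    ⟨fun a r w => by rw [hact, hact, map_smul, LinearMap.smul_apply]⟩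
  have hsum : ∀ (r : MonoidAlgebra F G), ∃ f : G → F, ∀ w : W', r • w = ∑ t, f t • ρ t w := by
    intro r
    induction r using MonoidAlgebra.induction_linear with
    | zero => exact ⟨0, fun w => by simp⟩
    | add a b ha hb =>
      obtain ⟨f, hf⟩ := ha
      obtain ⟨f', hf'⟩ := hb
      exact ⟨f + f', fun w => by simp [add_smul, hf, hf', Finset.sum_add_distrib]⟩
    | single g a =>
      classical
      exact ⟨Pi.single g a, fun w => by simp [hact, Pi.single_apply, ite_smul]⟩
  have hgen : ∀ r : MonoidAlgebra F G, ∀ c : F,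
      (∀ (s : MonoidAlgebra F G) (w : W'), r • s • w = s • r • w) →
      (∀ v, r • j v = c • j v) → ∀ w : W', r • w = c • w := by
    intro r c hr hv w
    have hw : w ∈ iSup S := hSs ▸ Submodule.mem_top
    induction hw using Submodule.iSup_induction' with
    | mem i y hy =>
      obtain ⟨g, rfl⟩ := QuotientGroup.mk_surjective i
      rw [hS] at hy
      obtain ⟨_, ⟨v, rfl⟩, rfl⟩ := hy
      rw [← hsingle, hr, hv, hsingle, hsingle, map_smul]
    | zero => simp
    | add a b _ _ ha hb => rw [smul_add, ha, hb, smul_add]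
  have hiso : IsIsotypic (MonoidAlgebra F G) W' := by
    apply aux_isotypic (F := F)
    intro r hr hidem
    obtain ⟨f, hf⟩ := hsum r
    have hpres : ∀ v, ∃ v', r • j v = j v' := by
      intro v
      rw [hf]
      refine aux_pres hH η (fun q : Fin m × Fin k => ηs q.2) (fun q => hirrs q.2) hdec
        (fun g hg q hq => hnot q.2 (aux_conj hH (hidx ▸ hp) (ηs q.2) g x hg hq))
        ρ j hj hjH S hS hSi f (fun g w => ?_) v
      rw [← hf, ← hf, ← hsingle, ← hsingle, hr]
    have hlin : ∀ (a : F) (w : W'), r • a • w = a • r • w := by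
      intro a w
      rw [hact, hact, map_smul]
    let N : Submodule F V :=
      { carrier := {v | r • j v = 0}
        add_mem' := fun {a b} ha hb => by
          simp only [Set.mem_ofPred_eq] at ha hb ⊢
          rw [map_add, smul_add, ha, hb, add_zero]
        zero_mem' := by simp
        smul_mem' := fun c a ha => by
          simp only [Set.mem_ofPred_eq] at ha ⊢
          rw [map_smul, hlin, ha, smul_zero] }
    have hN : ∀ v, v ∈ N ↔ r • j v = 0 := fun _ => Iff.rfl
    rcases hirr.2 N (fun h v hv => by
      rw [hN] at hv ⊢
      rw [hjH, ← hsingle, hr, hv, smul_zero]) with h | h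
    · right
      intro w
      rw [hgen r 1 hr (fun v => ?_) w, one_smul]
      obtain ⟨v', hv'⟩ := hpres v
      have : v' - v ∈ N := by
        rw [hN, map_sub, smul_sub, ← hv', hidem, sub_self]
      rw [h, Submodule.mem_bot, sub_eq_zero] at this
      rw [hv', this, one_smul]
    · left
      intro w
      rw [hgen r 0 hr (fun v => ?_) w, zero_smul]
      rw [zero_smul, ← hN, h]
      exact Submodule.mem_top
  have : Module.Finite (MonoidAlgebra F G) W' := Module.Finite.of_restrictScalars_finite F _ _
  obtain ⟨n, S', h1, h2, h3, h4⟩ := aux_decomp hiso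
  exact aux_final ρ hsingle S' h1 h2 h3 h4
end
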